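/- Let α = (α_i) be a bounded sequence of strictly positive numbers and β = (exp(α_i)). Then r(W_α) ≤ log(r(W_β)) and log(r(W_β)) equals the mean limit ℓ(W_α) = lim_n ‖Ŵ_α^{(n)}‖. -/

import Mathlib

open Filter Topology

/-- The `n`-th binomial mean of `α` starting at index `i`. -/
noncomputable def binomialMean (α : ℕ → ℝ) (n i : ℕ) : ℝ :=
  ((2 : ℝ) ^ n)⁻¹ * ∑ j ∈ Finset.range (n + 1), (n.choose j : ℝ) * α (i + j)

/-- The sum of the `n` consecutive terms of `α` starting at index `i`. -/
noncomputable def windowSum (α : ℕ → ℝ) (n i : ℕ) : ℝ :=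
  ∑ k ∈ Finset.range n, α (i + k)

/-- The supremum of all sums of `n` consecutive terms of `α`. -/
noncomputable def windowSup (α : ℕ → ℝ) (n : ℕ) : ℝ :=
  ⨆ i, windowSum α n i

theorem windowSum_add (α : ℕ → ℝ) (m n i : ℕ) :
    windowSum α (m + n) i = windowSum α m i + windowSum α n (i + m) := by
  simp only [windowSum, Finset.sum_range_add, add_assoc]

theorem sum_choose_real (n : ℕ) :
    ∑ j ∈ Finset.range (n + 1), (n.choose j : ℝ) = 2 ^ n := by
  exact_mod_cast Nat.sum_range_choose n

theorem sum_sq_mul_choose (n : ℕ) :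
    ∑ j ∈ Finset.range (n + 1), (2 * (j : ℝ) - n) ^ 2 * (n.choose j : ℝ) = (n : ℝ) * 2 ^ n := by
  have h := congrArg (Polynomial.eval (1 / 2 : ℝ)) (bernsteinPolynomial.variance ℝ n)
  simp only [Polynomial.eval_finsetSum, bernsteinPolynomial, Polynomial.eval_mul,
    Polynomial.eval_pow, Polynomial.eval_sub, Polynomial.eval_natCast, Polynomial.eval_X,
    Polynomial.eval_one, nsmul_eq_mul] at h
  have key : ∀ j ∈ Finset.range (n + 1), (2 * (j : ℝ) - n) ^ 2 * (n.choose j : ℝ) =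
      4 * 2 ^ n * (((n : ℝ) * (1 / 2) - j) ^ 2 *
        ((n.choose j : ℝ) * (1 / 2) ^ j * (1 - 1 / 2) ^ (n - j))) := by
    intro j hj
    have hp : (1 / 2 : ℝ) ^ j * (1 - 1 / 2) ^ (n - j) = (2 ^ n)⁻¹ := by
      rw [show (1 - 1 / 2 : ℝ) = 1 / 2 by norm_num, ← pow_add,
        Nat.add_sub_cancel' (Nat.lt_succ_iff.mp (Finset.mem_range.mp hj)), one_div, inv_pow]
    rw [mul_assoc (n.choose j : ℝ), hp]
    field_simp
    ring
  rw [Finset.sum_congr rfl key, ← Finset.mul_sum, h]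
  ring

theorem sum_abs_mul_choose_le (n : ℕ) :
    ∑ j ∈ Finset.range (n + 1), |2 * (j : ℝ) - n| * n.choose j ≤ 2 ^ n * √n := by
  have h := Finset.sum_mul_sq_le_sq_mul_sq (Finset.range (n + 1))
    (fun j => |2 * (j : ℝ) - n| * √(n.choose j : ℝ)) (fun j => √(n.choose j : ℝ))
  simp only [mul_pow, sq_abs, Real.sq_sqrt (Nat.cast_nonneg _), mul_assoc,
    Real.mul_self_sqrt (Nat.cast_nonneg _), sum_sq_mul_choose, sum_choose_real] at h
  refine abs_le_of_sq_le_sq' (h.trans_eq ?_) (by positivity) |>.2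
  rw [mul_pow, Real.sq_sqrt (Nat.cast_nonneg _)]
  ring

theorem binomialMean_succ_sub (α : ℕ → ℝ) (n i : ℕ) :
    2 ^ n * ((n : ℝ) + 1) * (binomialMean α n (i + 1) - binomialMean α n i) =
      ∑ j ∈ Finset.range (n + 1 + 1),
        (2 * (j : ℝ) - (n + 1 : ℕ)) * (n + 1).choose j * α (i + j) := by
  have hl : 2 ^ n * ((n : ℝ) + 1) * (binomialMean α n (i + 1) - binomialMean α n i) =
      (n + 1) * (∑ j ∈ Finset.range (n + 1), (n.choose j : ℝ) * α (i + (j + 1)) -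
        ∑ j ∈ Finset.range (n + 1 + 1), (n.choose j : ℝ) * α (i + j)) := by
    rw [Finset.sum_range_succ _ (n + 1), Nat.choose_succ_self]
    simp only [binomialMean, add_assoc, add_comm 1]
    field_simp
    simp
  rw [hl, Finset.sum_range_succ' _ (n + 1), Finset.sum_range_succ' _ (n + 1), ← sub_sub,
    ← Finset.sum_sub_distrib, mul_sub, Finset.mul_sum, sub_eq_add_neg]
  congr 1
  · refine Finset.sum_congr rfl fun j _ => ?_
    have h1 : ((n : ℝ) + 1) * n.choose j = (n + 1).choose (j + 1) * (j + 1) := by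
      exact_mod_cast Nat.add_one_mul_choose_eq n j
    have h2 : ((n + 1).choose (j + 1) : ℝ) = n.choose j + n.choose (j + 1) := by
      exact_mod_cast Nat.choose_succ_succ' n j
    push_cast
    linear_combination (2 * h1 + (n + 1) * h2) * α (i + (j + 1))
  · simp
    ring

section Bounded

variable {α : ℕ → ℝ} {C : ℝ}

theorem abs_binomialMean_succ_sub_le (h0 : ∀ i, 0 ≤ α i) (hC : ∀ i, α i ≤ C) (n i : ℕ) :
    |binomialMean α n (i + 1) - binomialMean α n i| ≤ 2 * C / √((n : ℝ) + 1) := by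
  have hC0 : 0 ≤ C := (h0 0).trans (hC 0)
  have h : 2 ^ n * ((n : ℝ) + 1) * |binomialMean α n (i + 1) - binomialMean α n i| ≤
      2 ^ (n + 1) * √((n : ℝ) + 1) * C := by
    calc _ = |2 ^ n * ((n : ℝ) + 1) * (binomialMean α n (i + 1) - binomialMean α n i)| := by
          rw [abs_mul, abs_of_nonneg (by positivity : (0 : ℝ) ≤ 2 ^ n * (n + 1))]
      _ ≤ ∑ j ∈ Finset.range (n + 1 + 1),
            |2 * (j : ℝ) - (n + 1 : ℕ)| * (n + 1).choose j * C := by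
          rw [binomialMean_succ_sub]
          refine (Finset.abs_sum_le_sum_abs _ _).trans (Finset.sum_le_sum fun j _ => ?_)
          rw [abs_mul, abs_mul, Nat.abs_cast, abs_of_nonneg (h0 _)]
          exact mul_le_mul_of_nonneg_left (hC _) (by positivity)
      _ ≤ _ := by
          rw [← Finset.sum_mul]
          exact mul_le_mul_of_nonneg_right
            (by exact_mod_cast sum_abs_mul_choose_le (n + 1)) hC0
  have hs : √((n : ℝ) + 1) * √((n : ℝ) + 1) = n + 1 := Real.mul_self_sqrt (by positivity)
  have hs0 : 0 < √((n : ℝ) + 1) := Real.sqrt_pos.2 (by positivity)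
  rw [le_div_iff₀ hs0]
  have hk : (0 : ℝ) < 2 ^ n * √((n : ℝ) + 1) := by positivity
  refine le_of_mul_le_mul_left ?_ hk
  calc _ = 2 ^ n * (√((n : ℝ) + 1) * √((n : ℝ) + 1)) *
        |binomialMean α n (i + 1) - binomialMean α n i| := by ring
    _ ≤ 2 ^ (n + 1) * √((n : ℝ) + 1) * C := by rwa [hs]
    _ = _ := by ring

theorem abs_binomialMean_add_sub_le (h0 : ∀ i, 0 ≤ α i) (hC : ∀ i, α i ≤ C) (n i k : ℕ) :
    |binomialMean α n (i + k) - binomialMean α n i| ≤ k * (2 * C / √((n : ℝ) + 1)) := by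
  induction k with
  | zero => simp
  | succ k ih =>
    have h := abs_binomialMean_succ_sub_le h0 hC n (i + k)
    have := abs_sub_le (binomialMean α n (i + k + 1)) (binomialMean α n (i + k))
      (binomialMean α n i)
    rw [← add_assoc]
    push_cast
    linarith

theorem sum_binomialMean (α : ℕ → ℝ) (n m i : ℕ) :
    ∑ k ∈ Finset.range m, binomialMean α n (i + k) = binomialMean (windowSum α m) n i := by
  simp only [binomialMean, windowSum, Finset.mul_sum]
  rw [Finset.sum_comm]
  refine Finset.sum_congr rfl fun j _ => Finset.sum_congr rfl fun k _ => ?_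
  rw [add_right_comm]

theorem binomialMean_le (n i : ℕ) (h : ∀ j ≤ n, α (i + j) ≤ C) : binomialMean α n i ≤ C := by
  rw [binomialMean, inv_mul_le_iff₀ (by positivity), ← sum_choose_real, Finset.sum_mul]
  exact Finset.sum_le_sum fun j hj => mul_le_mul_of_nonneg_left
    (h j (Nat.lt_succ_iff.mp (Finset.mem_range.mp hj))) (by positivity)

theorem le_binomialMean (n i : ℕ) (h : ∀ j ≤ n, C ≤ α (i + j)) : C ≤ binomialMean α n i := by
  rw [binomialMean, le_inv_mul_iff₀ (by positivity), ← sum_choose_real, Finset.sum_mul]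
  exact Finset.sum_le_sum fun j hj => mul_le_mul_of_nonneg_left
    (h j (Nat.lt_succ_iff.mp (Finset.mem_range.mp hj))) (by positivity)

theorem windowSum_nonneg (h0 : ∀ i, 0 ≤ α i) (n i : ℕ) : 0 ≤ windowSum α n i :=
  Finset.sum_nonneg fun _ _ => h0 _

theorem windowSum_le (hC : ∀ i, α i ≤ C) (n i : ℕ) : windowSum α n i ≤ n * C := by
  simpa [windowSum] using Finset.sum_le_card_nsmul (Finset.range n) (fun k => α (i + k)) C fun k _ => hC _

theorem windowSum_le_windowSup (hC : ∀ i, α i ≤ C) (n i : ℕ) :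
    windowSum α n i ≤ windowSup α n :=
  le_ciSup (f := windowSum α n) ⟨n * C, by rintro _ ⟨j, rfl⟩; exact windowSum_le hC n j⟩ i

theorem windowSup_nonneg (h0 : ∀ i, 0 ≤ α i) (n : ℕ) : 0 ≤ windowSup α n :=
  Real.iSup_nonneg fun i => windowSum_nonneg h0 n i

theorem subadditive_windowSup (hC : ∀ i, α i ≤ C) : Subadditive (windowSup α) := by
  intro m n
  refine ciSup_le fun i => ?_
  rw [windowSum_add]
  exact add_le_add (windowSum_le_windowSup hC m i) (windowSum_le_windowSup hC n _)

theorem bddBelow_windowSup_div (h0 : ∀ i, 0 ≤ α i) :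
    BddBelow (Set.range fun n : ℕ => windowSup α n / n) :=
  ⟨0, by rintro _ ⟨n, rfl⟩; exact div_nonneg (windowSup_nonneg h0 n) (Nat.cast_nonneg n)⟩

theorem exists_tendsto_windowSup_div (h0 : ∀ i, 0 ≤ α i) (hC : ∀ i, α i ≤ C) :
    ∃ L, 0 ≤ L ∧ Tendsto (fun n : ℕ => windowSup α n / n) atTop (𝓝 L) := by
  have h := (subadditive_windowSup hC).tendsto_lim (bddBelow_windowSup_div h0)
  exact ⟨_, ge_of_tendsto' h fun n => div_nonneg (windowSup_nonneg h0 n) (Nat.cast_nonneg n), h⟩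

theorem binomialMean_le_iSup (hC : ∀ i, α i ≤ C) (n i : ℕ) :
    binomialMean α n i ≤ ⨆ i, binomialMean α n i :=
  le_ciSup (f := binomialMean α n)
    ⟨C, by rintro _ ⟨j, rfl⟩; exact binomialMean_le n j fun _ _ => hC _⟩ i

theorem windowSup_le_iSup_binomialMean (h0 : ∀ i, 0 ≤ α i) (hC : ∀ i, α i ≤ C) (n m : ℕ) :
    windowSup α m ≤ m * (⨆ i, binomialMean α n i) + n * C := by
  have hC0 : 0 ≤ C := (h0 0).trans (hC 0)
  refine ciSup_le fun i => ?_
  have hle : windowSum α m i - n * C ≤ binomialMean (windowSum α m) n i := by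
    refine le_binomialMean n i fun j hj => ?_
    have h1 := windowSum_add α m j i
    have h2 := windowSum_add α j m i
    rw [add_comm j m] at h2
    have h3 := windowSum_nonneg h0 j (i + m)
    have h4 := windowSum_le hC j i
    have h5 : (j : ℝ) * C ≤ n * C := mul_le_mul_of_nonneg_right (by exact_mod_cast hj) hC0
    linarith
  rw [← sum_binomialMean] at hle
  have := Finset.sum_le_card_nsmul (Finset.range m) (fun k => binomialMean α n (i + k)) _
    fun k _ => binomialMean_le_iSup hC n (i + k)
  simp only [Finset.card_range, nsmul_eq_mul] at this
  linarith

theorem iSup_binomialMean_le (h0 : ∀ i, 0 ≤ α i) (hC : ∀ i, α i ≤ C) (n : ℕ) {m : ℕ}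
    (hm : m ≠ 0) :
    ⨆ i, binomialMean α n i ≤ windowSup α m / m + m * (2 * C / √((n : ℝ) + 1)) := by
  have hC0 : 0 ≤ C := (h0 0).trans (hC 0)
  have hm0 : (0 : ℝ) < m := by exact_mod_cast Nat.pos_of_ne_zero hm
  refine ciSup_le fun i => ?_
  have h1 : ∑ k ∈ Finset.range m, binomialMean α n (i + k) ≤ windowSup α m := by
    rw [sum_binomialMean]
    exact binomialMean_le n i fun j _ => windowSum_le_windowSup hC m _
  have h2 : m • (binomialMean α n i - m * (2 * C / √((n : ℝ) + 1))) ≤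
      ∑ k ∈ Finset.range m, binomialMean α n (i + k) := by
    conv_lhs => rw [← Finset.card_range m]
    refine Finset.card_nsmul_le_sum _ _ _ fun k hk => ?_
    have h3 := (abs_le.mp (abs_binomialMean_add_sub_le h0 hC n i k)).1
    have h4 : (k : ℝ) * (2 * C / √((n : ℝ) + 1)) ≤ m * (2 * C / √((n : ℝ) + 1)) :=
      mul_le_mul_of_nonneg_right (by exact_mod_cast (Finset.mem_range.mp hk).le) (by positivity)
    simp only [Finset.card_range]
    linarith
  rw [← sub_le_iff_le_add, le_div_iff₀ hm0]
  rw [nsmul_eq_mul] at h2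
  linarith

theorem tendsto_iSup_binomialMean (h0 : ∀ i, 0 ≤ α i) (hC : ∀ i, α i ≤ C) {L : ℝ}
    (hL : Tendsto (fun n : ℕ => windowSup α n / n) atTop (𝓝 L)) :
    Tendsto (fun n : ℕ => ⨆ i, binomialMean α n i) atTop (𝓝 L) := by
  refine tendsto_order.2 ⟨fun a ha => Eventually.of_forall fun n => ha.trans_le ?_,
    fun a ha => ?_⟩
  · have hlim : Tendsto (fun m : ℕ => (⨆ i, binomialMean α n i) + n * C / (m : ℝ)) atTop
        (𝓝 ((⨆ i, binomialMean α n i) + 0)) :=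
      tendsto_const_nhds.add (tendsto_const_div_atTop_nhds_zero_nat _)
    rw [add_zero] at hlim
    refine le_of_tendsto_of_tendsto hL hlim ?_
    filter_upwards [eventually_gt_atTop 0] with m hm
    have hm0 : (0 : ℝ) < m := by exact_mod_cast hm
    have := windowSup_le_iSup_binomialMean h0 hC n m
    rw [div_le_iff₀ hm0, add_mul, div_mul_cancel₀ _ hm0.ne']
    linarith
  · obtain ⟨m, hma, hm⟩ := ((hL.eventually_lt_const ha).and (eventually_gt_atTop 0)).exists
    have hlim : Tendsto (fun n : ℕ => windowSup α m / m + m * (2 * C / √((n : ℝ) + 1))) atTop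
        (𝓝 (windowSup α m / m + m * 0)) := by
      refine tendsto_const_nhds.add (tendsto_const_nhds.mul (tendsto_const_nhds.div_atTop ?_))
      exact Real.tendsto_sqrt_atTop.comp
        (tendsto_atTop_add_const_right _ _ tendsto_natCast_atTop_atTop)
    rw [mul_zero, add_zero] at hlim
    filter_upwards [hlim.eventually_lt_const hma] with n hn
    exact (iSup_binomialMean_le h0 hC n hm.ne').trans_lt hn

end Bounded

section Shift

variable {W : lp (fun _ : ℕ => ℂ) 2 →L[ℂ] lp (fun _ : ℕ => ℂ) 2} {w : ℕ → ℝ}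

theorem norm_le_of_forall_single {c : ℕ → ℝ} {n : ℕ} {M : ℝ}
    (hW : ∀ i : ℕ, W (lp.single 2 i 1) = (c i : ℂ) • lp.single 2 (i + n) 1)
    (hM : ∀ i, |c i| ≤ M) : ‖W‖ ≤ M := by
  have hM0 : 0 ≤ M := (abs_nonneg _).trans (hM 0)
  have hp : (0 : ℝ) < (2 : ENNReal).toReal := by norm_num
  refine W.opNorm_le_bound hM0 fun x => ?_
  have hs := lp.hasSum_single (by norm_num : (2 : ENNReal) ≠ ⊤) x
  have hWs : ∀ s : Finset ℕ, W (∑ i ∈ s, lp.single 2 i (x i)) =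
      ∑ j ∈ s.map (addRightEmbedding n),
        lp.single 2 j ((fun j => (c (j - n) : ℂ) * x (j - n)) j) := by
    intro s
    rw [map_sum, Finset.sum_map]
    refine Finset.sum_congr rfl fun i _ => ?_
    have h1 : ∀ (k : ℕ) (z : ℂ), lp.single (E := fun _ : ℕ => ℂ) 2 k z =
        z • lp.single (E := fun _ : ℕ => ℂ) 2 k 1 := by
      intro k z
      rw [← lp.single_smul, smul_eq_mul, mul_one]
    rw [h1 i, map_smul, hW, smul_smul, h1 _ (_ * _)]
    simp [mul_comm]
  refine le_of_tendsto_of_tendsto' ((W.continuous.tendsto x).comp hs).norm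
    (hs.norm.const_mul M) fun s => ?_
  simp only [Function.comp_apply]
  refine le_of_sq_le_sq ?_ (by positivity)
  have e1 := lp.norm_sum_single hp (fun j => (c (j - n) : ℂ) * x (j - n))
    (s.map (addRightEmbedding n))
  have e2 := lp.norm_sum_single hp (fun j => x j) s
  simp only [ENNReal.toReal_ofNat, Real.rpow_ofNat] at e1 e2
  rw [hWs, mul_pow, e1, e2, Finset.sum_map, Finset.mul_sum]
  refine Finset.sum_le_sum fun i _ => ?_
  simp only [addRightEmbedding_apply, Nat.add_sub_cancel, norm_mul, mul_pow, Complex.norm_real,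
    Real.norm_eq_abs]
  exact mul_le_mul_of_nonneg_right (pow_le_pow_left₀ (abs_nonneg _) (hM i) 2) (by positivity)

theorem weightedShift_pow_single
    (hW : ∀ i : ℕ, W (lp.single 2 i 1) = (w i : ℂ) • lp.single 2 (i + 1) 1) (n i : ℕ) :
    (W ^ n) (lp.single 2 i 1) =
      ((∏ k ∈ Finset.range n, w (i + k) : ℝ) : ℂ) • lp.single 2 (i + n) 1 := by
  induction n with
  | zero => simp
  | succ n ih =>
    rw [pow_succ', mul_apply_eq_comp, ih, map_smul, hW, smul_smul,
      Finset.prod_range_succ, ← add_assoc]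
    push_cast
    rfl

theorem prod_le_norm_weightedShift_pow
    (hW : ∀ i : ℕ, W (lp.single 2 i 1) = (w i : ℂ) • lp.single 2 (i + 1) 1) (n i : ℕ) :
    ∏ k ∈ Finset.range n, w (i + k) ≤ ‖W ^ n‖ := by
  have h := (W ^ n).le_opNorm (lp.single 2 i 1)
  rw [weightedShift_pow_single hW, norm_smul, lp.norm_single (by norm_num),
    lp.norm_single (by norm_num), norm_one, mul_one, mul_one, Complex.norm_real,
    Real.norm_eq_abs] at h
  exact (le_abs_self _).trans h

theorem norm_weightedShift_pow_le (hw : ∀ i, 0 ≤ w i)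
    (hW : ∀ i : ℕ, W (lp.single 2 i 1) = (w i : ℂ) • lp.single 2 (i + 1) 1) {n : ℕ} {M : ℝ}
    (hM : ∀ i, ∏ k ∈ Finset.range n, w (i + k) ≤ M) : ‖W ^ n‖ ≤ M :=
  norm_le_of_forall_single (weightedShift_pow_single hW n) fun i => by
    rw [abs_of_nonneg (Finset.prod_nonneg fun _ _ => hw _)]
    exact hM i

end Shift

theorem prod_le_windowSum_div_pow {α : ℕ → ℝ} (h0 : ∀ i, 0 ≤ α i) {n : ℕ} (hn : n ≠ 0) (i : ℕ) :
    ∏ k ∈ Finset.range n, α (i + k) ≤ (windowSum α n i / n) ^ n := by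
  have h := Real.geom_mean_le_arith_mean (Finset.range n) (fun _ => 1) (fun k => α (i + k))
    (fun _ _ => zero_le_one) (by simpa using Nat.pos_of_ne_zero hn) fun _ _ => h0 _
  simp only [Real.rpow_one, one_mul, Finset.sum_const, Finset.card_range, nsmul_eq_mul,
    mul_one] at h
  have hP : 0 ≤ ∏ k ∈ Finset.range n, α (i + k) := Finset.prod_nonneg fun _ _ => h0 _
  calc _ = ((∏ k ∈ Finset.range n, α (i + k)) ^ (n : ℝ)⁻¹) ^ n :=
        (Real.rpow_inv_natCast_pow hP hn).symm
    _ ≤ _ := pow_le_pow_left₀ (Real.rpow_nonneg hP _) h n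

theorem mean_limit_eq_log_spectral_radius
    (α : ℕ → ℝ) (hpos : ∀ i, 0 < α i) (hbdd : BddAbove (Set.range α))
    (Wa Wb : lp (fun _ : ℕ => ℂ) 2 →L[ℂ] lp (fun _ : ℕ => ℂ) 2)
    (hWa : ∀ i : ℕ, Wa (lp.single 2 i 1) = (α i : ℂ) • lp.single 2 (i + 1) 1)
    (hWb : ∀ i : ℕ, Wb (lp.single 2 i 1) =
      (Real.exp (α i) : ℂ) • lp.single 2 (i + 1) 1) :
    Tendsto
      (fun n : ℕ => ⨆ i : ℕ,
        ((2 : ℝ) ^ n)⁻¹ * ∑ j ∈ Finset.range (n + 1), (n.choose j : ℝ) * α (i + j))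
      atTop (nhds (Real.log (spectralRadius ℂ Wb).toReal)) ∧
    (spectralRadius ℂ Wa).toReal ≤ Real.log (spectralRadius ℂ Wb).toReal := by
  obtain ⟨C, hC'⟩ := hbdd
  have hC : ∀ i, α i ≤ C := fun i => hC' ⟨i, rfl⟩
  have h0 : ∀ i, 0 ≤ α i := fun i => (hpos i).le
  obtain ⟨L, hL0, hL⟩ := exists_tendsto_windowSup_div h0 hC
  have hprod : ∀ n i, ∏ k ∈ Finset.range n, Real.exp (α (i + k)) = Real.exp (windowSum α n i) :=
    fun n i => (Real.exp_sum _ _).symm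
  have hnorm : ∀ n, ‖Wb ^ n‖ = Real.exp (windowSup α n) := by
    intro n
    have hle := fun i => prod_le_norm_weightedShift_pow hWb n i
    simp only [hprod] at hle
    have hpos' : 0 < ‖Wb ^ n‖ := (Real.exp_pos _).trans_le (hle 0)
    refine le_antisymm (norm_weightedShift_pow_le (fun i => (Real.exp_pos (α i)).le) hWb ?_) ?_
    · intro i
      rw [hprod]
      exact Real.exp_le_exp.2 (windowSum_le_windowSup hC n i)
    · rw [← Real.le_log_iff_exp_le hpos']
      exact ciSup_le fun i => (Real.le_log_iff_exp_le hpos').2 (hle i)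
  have hb : spectralRadius ℂ Wb = ENNReal.ofReal (Real.exp L) := by
    refine tendsto_nhds_unique (spectrum.pow_norm_pow_one_div_tendsto_nhds_spectralRadius Wb) ?_
    simp only [hnorm, ← Real.exp_mul, mul_one_div]
    exact ENNReal.tendsto_ofReal ((Real.continuous_exp.tendsto L).comp hL)
  have hlog : Real.log (spectralRadius ℂ Wb).toReal = L := by
    rw [hb, ENNReal.toReal_ofReal (Real.exp_pos L).le, Real.log_exp]
  rw [hlog]
  refine ⟨tendsto_iSup_binomialMean h0 hC hL, ENNReal.toReal_le_of_le_ofReal hL0 ?_⟩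
  refine le_of_tendsto_of_tendsto
    (spectrum.pow_norm_pow_one_div_tendsto_nhds_spectralRadius Wa)
    (ENNReal.tendsto_ofReal hL) ?_
  filter_upwards [eventually_ne_atTop 0] with n hn
  refine ENNReal.ofReal_le_ofReal ?_
  have hM : 0 ≤ windowSup α n / n := div_nonneg (windowSup_nonneg h0 n) (Nat.cast_nonneg n)
  have hle : ‖Wa ^ n‖ ≤ (windowSup α n / n) ^ n := by
    refine norm_weightedShift_pow_le h0 hWa fun i => (prod_le_windowSum_div_pow h0 hn i).trans ?_
    have := windowSum_nonneg h0 n i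
    have := windowSum_le_windowSup hC n i
    gcongr
  calc ‖Wa ^ n‖ ^ (1 / n : ℝ) ≤ ((windowSup α n / n) ^ n) ^ (1 / n : ℝ) :=
        Real.rpow_le_rpow (norm_nonneg _) hle (by positivity)
    _ = windowSup α n / n := by rw [one_div, Real.pow_rpow_inv_natCast hM hn]
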